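/- arXiv:2107.06561 — 2 statements merged into one kernel-verified Lean document; each statement's English description precedes it below -/
import Mathlib

section
/- Let X be a quandle with operation ∗, R a ring, M a left R-module, and f₁, f₂ : X × X → R maps. If (f₁,f₂) is an Alexander pair, then the binary operation ◁ on X × M defined by (x,a) ◁ (y,b) = (x∗y, f₁(x,y)·a + f₂(x,y)·b) makes X × M into a quandle; that is: (i) (x,a) ◁ (x,a) = (x,a) for all (x,a) ∈ X × M, (ii) for every (y,b) ∈ X × M the map (x,a) ↦ (x,a) ◁ (y,b) is a bijection of X × M, and (iii) ((x,a) ◁ (y,b)) ◁ (z,c) = ((x,a) ◁ (z,c)) ◁ ((y,b) ◁ (z,c)) for all (x,a),(y,b),(z,c) ∈ X × M. -/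
/-- An Alexander pair for a binary operation `op` on `X` with values in a ring `R`. -/
def IsAlexanderPair {X R : Type*} [Ring R] (op : X → X → X) (f₁ f₂ : X → X → R) : Prop :=
  (∀ x, f₁ x x + f₂ x x = 1) ∧
  (∀ x y, IsUnit (f₁ x y)) ∧
  (∀ x y z, f₁ (op x y) z * f₁ x y = f₁ (op x z) (op y z) * f₁ x z) ∧
  (∀ x y z, f₁ (op x y) z * f₂ x y = f₂ (op x z) (op y z) * f₁ y z) ∧
  (∀ x y z, f₂ (op x y) z = f₁ (op x z) (op y z) * f₂ x z + f₂ (op x z) (op y z) * f₂ y z)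

/-- If `(f₁, f₂)` is an Alexander pair, then `(x,a) ◁ (y,b) = (x∗y, f₁(x,y)a + f₂(x,y)b)`
makes `X × M` into a quandle. -/
theorem quandle_structure_of_alexander_pair
    {X R M : Type*} [Ring R] [AddCommGroup M] [Module R M]
    (op : X → X → X)
    (hq1 : ∀ x, op x x = x)
    (hq2 : ∀ y, Function.Bijective (fun x => op x y))
    (hq3 : ∀ x y z, op (op x y) z = op (op x z) (op y z))
    (f₁ f₂ : X → X → R)
    (hf : IsAlexanderPair op f₁ f₂) :
    let tri : X × M → X × M → X × M :=
      fun p q => (op p.1 q.1, f₁ p.1 q.1 • p.2 + f₂ p.1 q.1 • q.2)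
    (∀ p, tri p p = p) ∧
    (∀ q, Function.Bijective (fun p => tri p q)) ∧
    (∀ p q r, tri (tri p q) r = tri (tri p r) (tri q r)) := by
  obtain ⟨h1, h2, h3, h4, h5⟩ := hf
  intro tri
  refine ⟨?_, ?_, ?_⟩
  · rintro ⟨x, a⟩
    simp only [tri, hq1, ← add_smul, h1, one_smul]
  · rintro ⟨y, b⟩
    constructor
    · rintro ⟨x, a⟩ ⟨x', a'⟩ h
      simp only [tri, Prod.mk.injEq] at h
      obtain ⟨hx, ha⟩ := h
      have hxx : x = x' := (hq2 y).1 hx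
      subst hxx
      have hb := add_right_cancel ha
      rw [(h2 x y).smul_left_cancel] at hb
      rw [hb]
    · rintro ⟨w, c⟩
      obtain ⟨x, hx⟩ := (hq2 y).2 w
      obtain ⟨u, hu⟩ := h2 x y
      refine ⟨(x, (↑u⁻¹ : R) • (c - f₂ x y • b)), ?_⟩
      simp only [tri, Prod.mk.injEq]
      refine ⟨hx, ?_⟩
      rw [← hu, smul_smul, Units.mul_inv, one_smul, sub_add_cancel]
  · rintro ⟨x, a⟩ ⟨y, b⟩ ⟨z, c⟩
    simp only [tri, Prod.mk.injEq]
    refine ⟨hq3 x y z, ?_⟩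
    simp only [smul_add, smul_smul]
    rw [h3, h4, h5 x y z, add_smul]
    abel
end

section
/- Let G be a group, R a commutative ring, and consider the ring R[G][t^{±1}] of Laurent polynomials over the group ring R[G]. Let X = Conj(G) be the conjugation quandle of G, with operation x∗y = y⁻¹xy. Define f₁, f₂ : X × X → R[G][t^{±1}] by f₁(x,y) = t·y⁻¹ and f₂(x,y) = y⁻¹x − t·y⁻¹. Then (f₁, f₂) is an Alexander pair. -/
theorem alexander_pair_aux {G A : Type*} [Group G] [Ring A] (c : G →* A) (t : A)
    (ht : IsUnit t) (hc : ∀ g, c g * t = t * c g) :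
    IsAlexanderPair (fun x y : G => y⁻¹ * x * y)
      (fun _ y => t * c y⁻¹) (fun x y => c (y⁻¹ * x) - t * c y⁻¹) := by
  have hm : ∀ g h, (t * c g) * (t * c h) = t * t * c (g * h) := by
    intro g h
    rw [mul_assoc, ← mul_assoc (c g), hc, map_mul]; simp only [mul_assoc]
  have h1 : ∀ g h, (t * c g) * c h = t * c (g * h) := by
    intro g h
    rw [mul_assoc, map_mul]
  have h2 : ∀ g h, c g * (t * c h) = t * c (g * h) := by
    intro g h
    rw [← mul_assoc, hc, mul_assoc, map_mul]
  have h3 : ∀ g h, c g * c h = c (g * h) := fun g h => (map_mul c g h).symm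
  refine ⟨?_, ?_, ?_, ?_, ?_⟩
  · intro x
    simp
  · intro x y
    exact ht.mul ((Group.isUnit y⁻¹).map c)
  · intro x y z
    simp only [hm]
    congr 2
    group
  · intro x y z
    simp only [mul_sub, sub_mul, hm, h1, h2]
    congr 3 <;> group
  · intro x y z
    simp only [mul_sub, sub_mul, hm, h1, h2, h3]
    have e1 : z⁻¹ * (y⁻¹ * x * y) = (z⁻¹ * y * z)⁻¹ * (z⁻¹ * x * z) * (z⁻¹ * y) := by group
    have e2 : (z⁻¹ * y * z)⁻¹ * (z⁻¹ * x) = (z⁻¹ * y * z)⁻¹ * (z⁻¹ * x * z) * z⁻¹ := by group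
    have e3 : (z⁻¹ * y * z)⁻¹ * (z⁻¹ * y) = z⁻¹ := by group
    rw [e1, e2, e3]
    abel

/-- On the conjugation quandle of a group `G`, the maps `f₁(x,y) = t·y⁻¹` and
`f₂(x,y) = y⁻¹x - t·y⁻¹` with values in `R[G][t^{±1}]` form an Alexander pair. -/
theorem alexander_pair_wada
    (G : Type*) [Group G] (R : Type*) [CommRing R] :
    IsAlexanderPair (fun x y : G => y⁻¹ * x * y)
      (fun _ y => (LaurentPolynomial.T 1 : LaurentPolynomial (MonoidAlgebra R G)) *
        LaurentPolynomial.C (MonoidAlgebra.of R G y⁻¹))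
      (fun x y => LaurentPolynomial.C (MonoidAlgebra.of R G (y⁻¹ * x)) -
        (LaurentPolynomial.T 1 : LaurentPolynomial (MonoidAlgebra R G)) *
        LaurentPolynomial.C (MonoidAlgebra.of R G y⁻¹)) := by
  exact alexander_pair_aux
    ((LaurentPolynomial.C (R := MonoidAlgebra R G)).toMonoidHom.comp (MonoidAlgebra.of R G))
    (LaurentPolynomial.T 1) (LaurentPolynomial.isUnit_T 1)
    (fun g => ((LaurentPolynomial.commute_T 1 _).eq).symm)
end
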